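/- Let ι be a nonempty finite index set and x : ι → ℝ. Then the Boltzmann operator Boltz^β(x) = (Σ_{i∈ι} x_i · exp(β·x_i)) / (Σ_{i∈ι} exp(β·x_i)) converges to max_{i∈ι} x_i as β → ∞. -/

import Mathlib

open Filter Topology

/-- For `c ≤ 0`, `exp (β * c)` tends to the indicator of `c = 0` as `β → ∞`. -/
theorem tendsto_exp_mul_atTop_of_nonpos {c : ℝ} (hc : c ≤ 0) :
    Tendsto (fun β : ℝ => Real.exp (β * c)) atTop (𝓝 (if c = 0 then 1 else 0)) := by
  split_ifs with h
  · simp [h]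
  · exact Real.tendsto_exp_atBot.comp
      (tendsto_id.atTop_mul_const_of_neg (lt_of_le_of_ne hc h))

/-- For a nonempty finite index set `ι` and `x : ι → ℝ`, the
Boltzmann operator `Boltz^β(x) = (∑_i x_i·exp(β·x_i)) / (∑_i exp(β·x_i))`
converges to `max_i x_i` as `β → ∞`. -/
theorem boltzmann_operator_tendsto_max {ι : Type*} [Fintype ι] [Nonempty ι]
    (x : ι → ℝ) :
    Tendsto
      (fun β : ℝ =>
        (∑ i : ι, x i * Real.exp (β * x i)) / (∑ i : ι, Real.exp (β * x i)))
      atTop (𝓝 (Finset.univ.sup' Finset.univ_nonempty x)) := by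
  obtain ⟨j, -, hj⟩ := Finset.exists_mem_eq_sup' Finset.univ_nonempty x
  have hle (i : ι) : x i ≤ x j := hj ▸ Finset.le_sup' x (Finset.mem_univ i)
  rw [hj]
  have hlim (i : ι) := tendsto_exp_mul_atTop_of_nonpos (sub_nonpos.2 (hle i))
  have hpos : 0 < ∑ i, if x i - x j = 0 then (1 : ℝ) else 0 :=
    Finset.sum_pos' (fun i _ => by split_ifs <;> norm_num) ⟨j, Finset.mem_univ j, by simp⟩
  have hquot := (tendsto_finsetSum Finset.univ fun i _ => (hlim i).const_mul (x i)).div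
    (tendsto_finsetSum Finset.univ fun i _ => hlim i) hpos.ne'
  have hval : (∑ i, x i * if x i - x j = 0 then (1 : ℝ) else 0) /
      (∑ i, if x i - x j = 0 then (1 : ℝ) else 0) = x j := by
    rw [div_eq_iff hpos.ne', Finset.mul_sum]
    refine Finset.sum_congr rfl fun i _ => ?_
    split_ifs with h
    · rw [sub_eq_zero.1 h]
    · simp
  rw [hval] at hquot
  refine hquot.congr fun β => ?_
  simp only [Pi.div_apply, mul_sub, Real.exp_sub, ← mul_div_assoc, ← Finset.sum_div]
  exact div_div_div_cancel_right₀ (Real.exp_ne_zero _) _ _
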